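/- arXiv:1610.07698 — 2 statements merged into one kernel-verified Lean document; each statement's English description precedes it below -/
import Mathlib

section
/- (Resolvent regularity estimates) Let d ≥ 1, β ∈ (0,1), θ ∈ (0,β), λ > 0, c > 0 and b ∈ C^β_b(ℝ^d). Let p: (0,∞) × ℝ^d × ℝ^d → [0,∞) be measurable such that for every t > 0 and y the map x ↦ p(t,x,y) is differentiable, and for all t > 0 and x, x′, y ∈ ℝ^d: ∫_{ℝ^d} p(t,x,y) dy = 1; p(t,x,y) ≤ c t (|x−y|+t)^{−d−1}; |∇_x p(t,x,y)| ≤ c (|x−y|+t)^{−d−1}; ∫_{ℝ^d} ∇_x p(t,x,y) dy = 0; and |∇_x p(t,x,y) − ∇_x p(t,x′,y)| ≤ c |x−x′|^θ t^{−θ} (|x̃−y|+t)^{−d−1}, where x̃ is whichever of x, x′ is nearer to y. Then there is a constant C > 0 depending only on d, β, θ and c such that: (i) u(x) := ∫_0^∞ e^{−λt} ∫_{ℝ^d} p(t,x,y) b(y) dy dt satisfies ‖u‖_∞ ≤ C λ^{−1} ‖b‖_∞; (ii) the integral v(x) := ∫_0^∞ e^{−λt} ∫_{ℝ^d} ∇_x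 p(t,x,y) (b(y) − b(x)) dy dt converges absolutely and ‖v‖_∞ ≤ C λ^{−β} ‖b‖_{C^β_b}; (iii) |v(x) − v(x′)| ≤ C λ^{θ−β} |x−x′|^θ ‖b‖_{C^β_b} for all x, x′ ∈ ℝ^d. -/
open MeasureTheory Real

theorem integrableOn_exp_neg_mul_mul_rpow {lam a : ℝ} (hlam : 0 < lam) (ha : 0 < a) :
    IntegrableOn (fun t => exp (-(lam * t)) * t ^ (a - 1)) (Set.Ioi 0) := by
  have h := integrableOn_rpow_mul_exp_neg_mul_rpow (p := 1) (s := a - 1) (b := lam)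
    (by linarith) one_pos hlam
  refine h.congr_fun (fun t _ => ?_) measurableSet_Ioi
  simp [mul_comm]

theorem integral_exp_neg_mul_mul_rpow {lam a : ℝ} (hlam : 0 < lam) (ha : 0 < a) :
    ∫ t in Set.Ioi (0 : ℝ), exp (-(lam * t)) * t ^ (a - 1) = lam ^ (-a) * Gamma a := by
  simp_rw [mul_comm (exp _)]
  rw [integral_rpow_mul_exp_neg_mul_Ioi ha hlam, one_div, inv_rpow hlam.le, rpow_neg hlam.le]

theorem abs_integral_exp_neg_mul_mul_integral_le {E : Type*} [MeasurableSpace E] {μ : Measure E}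
    {lam Mb : ℝ} (hlam : 0 < lam) {b : E → ℝ} (hb : ∀ y, |b y| ≤ Mb) {q : ℝ → E → ℝ}
    (hq : ∀ t, 0 < t → ∀ y, 0 ≤ q t y) (hq1 : ∀ t, 0 < t → ∫ y, q t y ∂μ = 1) :
    |∫ t in Set.Ioi (0 : ℝ), exp (-(lam * t)) * ∫ y, q t y * b y ∂μ| ≤ lam⁻¹ * Mb := by
  have hexp : IntegrableOn (fun t => exp (-(lam * t)) * t ^ ((1 : ℝ) - 1) * Mb) (Set.Ioi 0) :=
    (integrableOn_exp_neg_mul_mul_rpow hlam one_pos).mul_const Mb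
  rw [← norm_eq_abs]
  refine (norm_integral_le_of_norm_le hexp ?_).trans_eq ?_
  · filter_upwards [ae_restrict_mem measurableSet_Ioi] with t ht
    rw [norm_mul, norm_of_nonneg (exp_pos _).le, sub_self, rpow_zero, mul_one]
    gcongr
    have hqi : Integrable (q t) μ := Integrable.of_integral_ne_zero (by simp [hq1 t ht])
    refine (norm_integral_le_of_norm_le (hqi.mul_const Mb) (.of_forall fun y => ?_)).trans_eq ?_
    · rw [norm_mul, norm_of_nonneg (hq t ht y)]
      exact mul_le_mul_of_nonneg_left (hb y) (hq t ht y)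
    · rw [integral_mul_const, hq1 t ht, one_mul]
  · rw [integral_mul_const, integral_exp_neg_mul_mul_rpow hlam one_pos, Gamma_one, mul_one,
      rpow_neg_one]

theorem norm_add_rpow_eq_scaled {E : Type*} [NormedAddCommGroup E] [NormedSpace ℝ E] (z : E)
    {t : ℝ} (ht : 0 < t) (s : ℝ) :
    (‖z‖ + t) ^ s = t ^ s * (1 + ‖t⁻¹ • z‖) ^ s := by
  rw [← mul_rpow ht.le (by positivity), norm_smul, norm_inv, norm_of_nonneg ht.le]
  congr 1
  field_simp
  ring

theorem norm_smul_le_kernel {E F : Type*} [NormedAddCommGroup E] [NormedSpace ℝ E]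
    [NormedAddCommGroup F] [NormedSpace ℝ F] {b : E → ℝ} {β Hb c t : ℝ} (hβ : 0 ≤ β) (ht : 0 < t) (hHb : 0 ≤ Hb)
    (hb : ∀ x y, |b x - b y| ≤ Hb * ‖x - y‖ ^ β) {x y : E} {v : F}
    (hv : ‖v‖ ≤ c * (‖x - y‖ + t) ^ (-(Module.finrank ℝ E : ℝ) - 1)) :
    ‖(b y - b x) • v‖ ≤ c * Hb * (‖x - y‖ + t) ^ (β - Module.finrank ℝ E - 1) := by
  have hpos : 0 < ‖x - y‖ + t := by positivity
  have hb' : |b y - b x| ≤ Hb * (‖x - y‖ + t) ^ β := by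
    refine (hb y x).trans ?_
    rw [norm_sub_rev]
    gcongr
    linarith
  rw [norm_smul, norm_eq_abs]
  refine (mul_le_mul hb' hv (norm_nonneg _) (by positivity)).trans_eq ?_
  rw [show β - Module.finrank ℝ E - 1 = β + (-(Module.finrank ℝ E : ℝ) - 1) by ring,
    rpow_add hpos]
  ring

theorem min_norm_add_rpow_le {E : Type*} [NormedAddCommGroup E] (x x' y : E) {t : ℝ} (ht : 0 < t) (hr : ‖x - x'‖ ≤ t) {s : ℝ}
    (hs : 0 ≤ s) :
    (min ‖x - y‖ ‖x' - y‖ + t) ^ (-s) ≤ 2 ^ s * (‖x - y‖ + t) ^ (-s) := by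
  have hpos : 0 < ‖x - y‖ + t := by positivity
  have htri : ‖x - y‖ ≤ ‖x - x'‖ + ‖x' - y‖ := norm_sub_le_norm_sub_add_norm_sub x x' y
  have hle : (‖x - y‖ + t) / 2 ≤ min ‖x - y‖ ‖x' - y‖ + t := by
    rcases min_cases ‖x - y‖ ‖x' - y‖ with h | h <;> rw [h.1] <;>
      linarith [norm_nonneg (x - y), norm_nonneg (x' - y)]
  refine (rpow_le_rpow_of_nonpos (by positivity) hle (by linarith)).trans_eq ?_
  rw [div_rpow hpos.le two_pos.le, rpow_neg two_pos.le, div_inv_eq_mul, mul_comm]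

section Kernel

variable {E : Type*} [NormedAddCommGroup E] [NormedSpace ℝ E] [FiniteDimensional ℝ E]
  [MeasurableSpace E] [BorelSpace E] (μ : Measure E) [μ.IsAddHaarMeasure]

theorem integrable_norm_sub_add_rpow (x : E) {t : ℝ} (ht : 0 < t) {s : ℝ}
    (hs : s < -(Module.finrank ℝ E : ℝ)) :
    Integrable (fun y => (‖x - y‖ + t) ^ s) μ := by
  have h : Integrable (fun z : E => (1 + ‖z‖) ^ s) μ := by
    simpa using integrable_one_add_norm (μ := μ) (r := -s) (by linarith)
  have h' := (((integrable_comp_smul_iff μ _ (inv_ne_zero ht.ne')).2 h).const_mul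
    (t ^ s)).comp_sub_left x
  simpa only [norm_add_rpow_eq_scaled _ ht] using h'

theorem integral_norm_sub_add_rpow (x : E) {t : ℝ} (ht : 0 < t) (s : ℝ) :
    ∫ y, (‖x - y‖ + t) ^ s ∂μ =
      (∫ y, (1 + ‖y‖) ^ s ∂μ) * t ^ (Module.finrank ℝ E + s) := by
  rw [integral_sub_left_eq_self (fun z => (‖z‖ + t) ^ s) μ x]
  simp_rw [norm_add_rpow_eq_scaled _ ht]
  rw [integral_const_mul,
    Measure.integral_comp_inv_smul_of_nonneg μ (fun z : E => (1 + ‖z‖) ^ s) ht.le,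
    rpow_add ht, rpow_natCast, smul_eq_mul]
  ring

variable {F : Type*} [NormedAddCommGroup F]

theorem norm_integral_le_of_norm_le_kernel [NormedSpace ℝ F] {x : E} {t A β : ℝ} (ht : 0 < t) (hβ : β < 1)
    {g : E → F}
    (hg : ∀ y, ‖g y‖ ≤ A * (‖x - y‖ + t) ^ (β - Module.finrank ℝ E - 1)) :
    ‖∫ y, g y ∂μ‖ ≤
      A * (∫ y, (1 + ‖y‖) ^ (β - Module.finrank ℝ E - 1) ∂μ) * t ^ (β - 1) := by
  have hki := (integrable_norm_sub_add_rpow μ x ht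
    (s := β - Module.finrank ℝ E - 1) (by linarith)).const_mul A
  refine (norm_integral_le_of_norm_le hki (.of_forall hg)).trans_eq ?_
  rw [integral_const_mul, integral_norm_sub_add_rpow μ x ht, mul_assoc]
  congr 3
  ring

theorem integrable_prod_of_norm_le_kernel {x : E} {lam A β : ℝ} (hlam : 0 < lam)
    (hβ0 : 0 < β) (hβ : β < 1) {g : ℝ × E → F}
    (hgm : AEStronglyMeasurable g ((volume.restrict (Set.Ioi 0)).prod μ))
    (hg : ∀ t, 0 < t → ∀ y, ‖g (t, y)‖ ≤
      exp (-(lam * t)) * A * (‖x - y‖ + t) ^ (β - Module.finrank ℝ E - 1)) :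
    Integrable g ((volume.restrict (Set.Ioi 0)).prod μ) := by
  rw [integrable_prod_iff hgm]
  constructor
  · filter_upwards [hgm.prodMk_left, ae_restrict_mem measurableSet_Ioi] with t htm ht
    exact ((integrable_norm_sub_add_rpow μ x ht (by linarith)).const_mul _).mono' htm
      (.of_forall (hg t ht))
  · have hki := (integrableOn_exp_neg_mul_mul_rpow hlam hβ0).const_mul
      (A * ∫ y, (1 + ‖y‖) ^ (β - Module.finrank ℝ E - 1) ∂μ)
    refine hki.mono' hgm.norm.integral_prod_right' ?_
    filter_upwards [ae_restrict_mem measurableSet_Ioi] with t ht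
    refine (norm_integral_le_of_norm_le_kernel μ ht hβ (g := fun y => ‖g (t, y)‖)
      (x := x) (A := exp (-(lam * t)) * A) (fun y => ?_)).trans_eq (by ring)
    simpa using hg t ht y

variable [NormedSpace ℝ F]

theorem norm_integral_smul_sub_integral_smul_le {b : E → ℝ} {β θ c Mb Hb t : ℝ}
    (hβ0 : 0 < β) (hβ : β < 1) (hθ : 0 ≤ θ) (hc : 0 ≤ c) (ht : 0 < t) (hbm : Measurable b)
    (hbM : ∀ x, |b x| ≤ Mb) (hHb : 0 ≤ Hb) (hb : ∀ x y, |b x - b y| ≤ Hb * ‖x - y‖ ^ β)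
    {x x' : E} {g g' : E → F} (hgm : AEStronglyMeasurable g μ) (hgm' : AEStronglyMeasurable g' μ)
    (hg : ∀ y, ‖g y‖ ≤ c * (‖x - y‖ + t) ^ (-(Module.finrank ℝ E : ℝ) - 1))
    (hg' : ∀ y, ‖g' y‖ ≤ c * (‖x' - y‖ + t) ^ (-(Module.finrank ℝ E : ℝ) - 1))
    (hg0' : ∫ y, g' y ∂μ = 0)
    (hgg' : ∀ y, ‖g y - g' y‖ ≤ c * ‖x - x'‖ ^ θ * t ^ (-θ) *
      (min ‖x - y‖ ‖x' - y‖ + t) ^ (-(Module.finrank ℝ E : ℝ) - 1)) :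
    ‖(∫ y, (b y - b x) • g y ∂μ) - ∫ y, (b y - b x') • g' y ∂μ‖ ≤
      c * (∫ y, (1 + ‖y‖) ^ (β - Module.finrank ℝ E - 1) ∂μ) *
        (2 + 2 ^ (Module.finrank ℝ E + 1 : ℝ)) * Hb * ‖x - x'‖ ^ θ * t ^ (β - θ - 1) := by
  set K := ∫ y, (1 + ‖y‖) ^ (β - Module.finrank ℝ E - 1) ∂μ with hK
  have hK0 : 0 ≤ K := integral_nonneg fun y => by positivity
  have hsplit : t ^ (β - θ - 1) = t ^ (-θ) * t ^ (β - 1) := by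
    rw [← rpow_add ht]
    congr 1
    ring
  rw [hsplit]
  have hconst : (0 : ℝ) ≤ 2 ^ (Module.finrank ℝ E + 1 : ℝ) := by positivity
  have hR : 0 ≤ c * K * Hb * (‖x - x'‖ ^ θ * t ^ (-θ)) * t ^ (β - 1) := by positivity
  rcases lt_or_ge t ‖x - x'‖ with hr | hr
  · have h1 := norm_integral_le_of_norm_le_kernel μ ht hβ
      (fun y => norm_smul_le_kernel hβ0.le ht hHb hb (hg y))
    have h2 := norm_integral_le_of_norm_le_kernel μ ht hβ
      (fun y => norm_smul_le_kernel hβ0.le ht hHb hb (hg' y))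
    have hone : 1 ≤ ‖x - x'‖ ^ θ * t ^ (-θ) := by
      rw [rpow_neg ht.le, ← div_eq_mul_inv, ← div_rpow (norm_nonneg _) ht.le]
      exact one_le_rpow ((one_le_div ht).2 hr.le) hθ
    have h3 : c * K * Hb * t ^ (β - 1) ≤
        c * K * Hb * (‖x - x'‖ ^ θ * t ^ (-θ)) * t ^ (β - 1) := by
      refine mul_le_mul_of_nonneg_right ?_ (by positivity)
      exact le_mul_of_one_le_right (by positivity) hone
    refine (norm_sub_le _ _).trans ((add_le_add h1 h2).trans ?_)
    rw [← hK]
    nlinarith [mul_nonneg hR hconst]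
  · have hki : ∀ z, ∀ h : E → F, AEStronglyMeasurable h μ →
        (∀ y, ‖h y‖ ≤ c * (‖z - y‖ + t) ^ (-(Module.finrank ℝ E : ℝ) - 1)) →
        Integrable h μ := fun z h hm hh =>
      ((integrable_norm_sub_add_rpow μ z ht (by linarith)).const_mul c).mono' hm (.of_forall hh)
    have hi := hki x g hgm hg
    have hi' := hki x' g' hgm' hg'
    have hib : ∀ h : E → F, Integrable h μ → ∀ z, Integrable (fun y => (b y - b z) • h y) μ := by
      intro h hh z
      refine hh.bdd_smul (Mb + Mb) (hbm.sub_const _).aestronglyMeasurable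
        (.of_forall fun y => ?_)
      exact (norm_sub_le _ _).trans (add_le_add (hbM y) (hbM z))
    have hshift : ∫ y, (b y - b x') • g' y ∂μ = ∫ y, (b y - b x) • g' y ∂μ := by
      have h : ∀ y, (b y - b x') • g' y = (b y - b x) • g' y + (b x - b x') • g' y := fun y => by
        rw [← add_smul]
        congr 1
        ring
      simp_rw [h]
      rw [integral_add (hib g' hi' x) (hi'.fun_smul (b x - b x')), integral_smul, hg0', smul_zero, add_zero]
    rw [hshift, ← integral_sub (hib g hi x) (hib g' hi' x)]
    simp_rw [← smul_sub]
    refine (norm_integral_le_of_norm_le_kernel μ (x := x) ht hβ (fun y => norm_smul_le_kernel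
      (c := c * ‖x - x'‖ ^ θ * t ^ (-θ) * 2 ^ (Module.finrank ℝ E + 1 : ℝ))
      hβ0.le ht hHb hb ((hgg' y).trans ?_))).trans ?_
    · rw [mul_assoc _ ((2 : ℝ) ^ _)]
      gcongr
      simpa only [neg_add'] using min_norm_add_rpow_le x x' y ht hr
        (s := Module.finrank ℝ E + 1) (by positivity)
    · rw [← hK]
      nlinarith

end Kernel

section Gradient

variable {E : Type*} [NormedAddCommGroup E] [InnerProductSpace ℝ E] [FiniteDimensional ℝ E]
  [MeasurableSpace E] [BorelSpace E]

theorem measurable_gradient_of_parameter {α : Type*} [MeasurableSpace α] {f : α → E → ℝ}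
    (hf : ∀ x, Measurable fun a => f a x) (x : E)
    (hd : ∀ a, DifferentiableAt ℝ (f a) x) :
    Measurable fun a => gradient (f a) x := by
  have hcoord : ∀ v : E, Measurable fun a => inner ℝ v (gradient (f a) x) := by
    intro v
    refine measurable_of_tendsto_metrizable (f := fun (n : ℕ) a =>
      (n : ℝ) • (f a (x + (n : ℝ)⁻¹ • v) - f a x))
      (fun n => ((hf _).sub (hf _)).const_smul (n : ℝ)) ?_
    rw [tendsto_pi_nhds]
    intro a
    rw [real_inner_comm, inner_gradient_left]
    refine (hd a).hasFDerivAt.lim v ?_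
    simpa using tendsto_natCast_atTop_atTop (R := ℝ)
  have hsum : (fun a => gradient (f a) x) = fun a =>
      ∑ i, inner ℝ (stdOrthonormalBasis ℝ E i) (gradient (f a) x) •
        stdOrthonormalBasis ℝ E i := by
    funext a
    exact ((stdOrthonormalBasis ℝ E).sum_repr' _).symm
  rw [hsum]
  exact Finset.measurable_fun_sum _ fun i _ => (hcoord _).smul_const _

theorem measurable_gradient_snd {p : ℝ → E → E → ℝ}
    (hp : Measurable fun w : ℝ × E × E => p w.1 w.2.1 w.2.2) {t : ℝ}
    (hd : ∀ y, Differentiable ℝ fun x => p t x y) (x : E) :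
    Measurable fun y => gradient (fun x' => p t x' y) x :=
  measurable_gradient_of_parameter (f := fun y x => p t x y)
    (fun _ => hp.comp (measurable_const.prodMk (measurable_const.prodMk measurable_id)))
    x (fun y => hd y x)

theorem aestronglyMeasurable_gradient_prod {p : ℝ → E → E → ℝ}
    (hp : Measurable fun w : ℝ × E × E => p w.1 w.2.1 w.2.2)
    (hd : ∀ t, 0 < t → ∀ y, Differentiable ℝ fun x => p t x y) (x : E)
    (μ : Measure E) [SFinite μ] :
    AEStronglyMeasurable (fun w : ℝ × E => gradient (fun x' => p w.1 x' w.2) x)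
      ((volume.restrict (Set.Ioi 0)).prod μ) := by
  have hm : Measurable fun w : ℝ × E =>
      gradient (fun x' => if 0 < w.1 then p w.1 x' w.2 else 0) x := by
    refine measurable_gradient_of_parameter
      (f := fun (w : ℝ × E) x' => if 0 < w.1 then p w.1 x' w.2 else 0) (fun x' => ?_) x ?_
    · exact Measurable.ite (measurableSet_lt measurable_const measurable_fst)
        (hp.comp (measurable_fst.prodMk (measurable_const.prodMk measurable_snd)))
        measurable_const
    · rintro ⟨t, y⟩
      by_cases ht : 0 < t
      · simpa [ht] using hd t ht y x
      · simp [ht]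
  refine hm.aestronglyMeasurable.congr ?_
  have hpos : ∀ᵐ w ∂((volume.restrict (Set.Ioi (0 : ℝ))).prod μ), 0 < w.1 :=
    Measure.quasiMeasurePreserving_fst.ae (ae_restrict_mem measurableSet_Ioi)
  filter_upwards [hpos] with w hw
  simp [hw]

end Gradient

/-- Resolvent regularity estimates: if `p(t,x,y)` is a transition density satisfying the
bounds of Theorem 1.1, then `u = ∫_0^∞ e^{-λt} P_t b dt` satisfies `‖u‖_∞ ≤ C λ⁻¹ ‖b‖_∞`,
and `v(x) = ∫_0^∞ e^{-λt} ∫ ∇_x p(t,x,y)(b(y)-b(x)) dy dt` converges absolutely with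
`‖v‖_∞ ≤ C λ^{-β} ‖b‖_{C^β_b}` and `[v]_θ ≤ C λ^{θ-β} ‖b‖_{C^β_b}`. -/
theorem stmt_6 (d : ℕ) (hd : 1 ≤ d) (β θ : ℝ) (hβ : β ∈ Set.Ioo (0:ℝ) 1)
    (hθ : θ ∈ Set.Ioo (0:ℝ) β) (c : ℝ) (hc : 0 < c) :
    ∃ C > (0:ℝ), ∀ lam : ℝ, 0 < lam →
    ∀ (b : EuclideanSpace ℝ (Fin d) → ℝ) (Mb Hb : ℝ),
      Measurable b → (∀ x, |b x| ≤ Mb) → (∀ x y, |b x - b y| ≤ Hb * ‖x - y‖ ^ β) →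
    ∀ p : ℝ → EuclideanSpace ℝ (Fin d) → EuclideanSpace ℝ (Fin d) → ℝ,
      Measurable (fun w : ℝ × EuclideanSpace ℝ (Fin d) × EuclideanSpace ℝ (Fin d) =>
        p w.1 w.2.1 w.2.2) →
      (∀ t, 0 < t → ∀ x y, 0 ≤ p t x y) →
      (∀ t, 0 < t → ∀ y, Differentiable ℝ (fun x => p t x y)) →
      (∀ t, 0 < t → ∀ x, (∫ y, p t x y) = 1) →
      (∀ t, 0 < t → ∀ x y, p t x y ≤ c * t * (‖x - y‖ + t) ^ (-(d:ℝ) - 1)) →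
      (∀ t, 0 < t → ∀ x y,
        ‖gradient (fun x' => p t x' y) x‖ ≤ c * (‖x - y‖ + t) ^ (-(d:ℝ) - 1)) →
      (∀ t, 0 < t → ∀ x,
        (∫ y, gradient (fun x' => p t x' y) x) = 0) →
      (∀ t, 0 < t → ∀ x x' y,
        ‖gradient (fun z => p t z y) x - gradient (fun z => p t z y) x'‖ ≤
          c * ‖x - x'‖ ^ θ * t ^ (-θ) * (min ‖x - y‖ ‖x' - y‖ + t) ^ (-(d:ℝ) - 1)) →
      -- (i) sup bound on u
      ((∀ x, |∫ t in Set.Ioi (0:ℝ), Real.exp (-(lam * t)) * ∫ y, p t x y * b y| ≤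
          C * lam⁻¹ * Mb) ∧
      -- (ii) absolute convergence of the integral defining v
      (∀ x, Integrable (fun w : ℝ × EuclideanSpace ℝ (Fin d) =>
          Real.exp (-(lam * w.1)) *
            (‖gradient (fun x' => p w.1 x' w.2) x‖ * |b w.2 - b x|))
          ((volume.restrict (Set.Ioi (0:ℝ))).prod volume)) ∧
      -- (ii) sup bound on v
      (∀ x, ‖∫ t in Set.Ioi (0:ℝ), ∫ y,
          (Real.exp (-(lam * t)) * (b y - b x)) • gradient (fun x' => p t x' y) x‖ ≤
          C * lam ^ (-β) * (Mb + Hb)) ∧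
      -- (iii) θ-Hölder bound on v
      (∀ x x', ‖(∫ t in Set.Ioi (0:ℝ), ∫ y,
          (Real.exp (-(lam * t)) * (b y - b x)) • gradient (fun z => p t z y) x) -
          ∫ t in Set.Ioi (0:ℝ), ∫ y,
          (Real.exp (-(lam * t)) * (b y - b x')) • gradient (fun z => p t z y) x'‖ ≤
          C * lam ^ (θ - β) * ‖x - x'‖ ^ θ * (Mb + Hb))) := by
  have hβ0 := hβ.1
  have hβ1 := hβ.2
  have hθ0 := hθ.1
  have hβθ : 0 < β - θ := sub_pos.2 hθ.2
  have hfin : Module.finrank ℝ (EuclideanSpace ℝ (Fin d)) = d := finrank_euclideanSpace_fin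
  set K := ∫ y : EuclideanSpace ℝ (Fin d), (1 + ‖y‖) ^ (β - d - 1) with hK
  have hK0 : 0 ≤ K := integral_nonneg fun y => by positivity
  have hΓ1 := Gamma_pos_of_pos hβ0
  have hΓ2 := Gamma_pos_of_pos hβθ
  set C₁ := c * K * Gamma β with hC₁
  set C₂ := c * K * (2 + 2 ^ (d + 1 : ℝ)) * Gamma (β - θ) with hC₂
  have hC₁0 : 0 ≤ C₁ := by positivity
  have hC₂0 : 0 ≤ C₂ := by positivity
  refine ⟨1 + C₁ + C₂, by positivity, ?_⟩
  intro lam hlam b Mb Hb hbm hbM hbH p hpm hp0 hpd hp1 _ hpg hpg0 hpgg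
  have hMb : 0 ≤ Mb := (abs_nonneg _).trans (hbM 0)
  have hHb : 0 ≤ Hb := by
    have h := (abs_nonneg _).trans (hbH (EuclideanSpace.single ⟨0, hd⟩ 1) 0)
    simpa using h
  set I : EuclideanSpace ℝ (Fin d) → ℝ → EuclideanSpace ℝ (Fin d) := fun x t =>
    ∫ y, (b y - b x) • gradient (fun x' => p t x' y) x
  have hscale : ∀ x t, ∫ y, (exp (-(lam * t)) * (b y - b x)) •
      gradient (fun x' => p t x' y) x = exp (-(lam * t)) • I x t := by
    intro x t
    simp_rw [mul_smul]
    rw [integral_smul]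
  have hbound : ∀ x t, 0 < t → ∀ y, ‖(exp (-(lam * t)) * (b y - b x)) •
      gradient (fun x' => p t x' y) x‖ ≤
      exp (-(lam * t)) * (c * Hb) *
        (‖x - y‖ + t) ^ (β - Module.finrank ℝ (EuclideanSpace ℝ (Fin d)) - 1) := by
    intro x t ht y
    rw [mul_smul, norm_smul, norm_of_nonneg (exp_pos _).le, mul_assoc]
    gcongr
    exact norm_smul_le_kernel hβ0.le ht hHb hbH
      (by simpa only [hfin] using hpg t ht x y)
  have hintprod : ∀ x, Integrable (fun w : ℝ × EuclideanSpace ℝ (Fin d) =>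
      (exp (-(lam * w.1)) * (b w.2 - b x)) • gradient (fun x' => p w.1 x' w.2) x)
      ((volume.restrict (Set.Ioi (0:ℝ))).prod volume) := by
    intro x
    have hm : Measurable fun w : ℝ × EuclideanSpace ℝ (Fin d) =>
        exp (-(lam * w.1)) * (b w.2 - b x) :=
      (measurable_fst.const_mul lam).neg.exp.mul ((hbm.comp measurable_snd).sub_const _)
    refine integrable_prod_of_norm_le_kernel volume (x := x) (A := c * Hb) hlam hβ0 hβ1
      (hm.aestronglyMeasurable.smul (aestronglyMeasurable_gradient_prod hpm hpd x volume))
      (hbound x)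
  refine ⟨fun x => ?_, fun x => ?_, fun x => ?_, fun x x' => ?_⟩
  · refine (abs_integral_exp_neg_mul_mul_integral_le hlam hbM (fun t ht => hp0 t ht x)
      (fun t ht => hp1 t ht x)).trans ?_
    rw [mul_assoc]
    exact le_mul_of_one_le_left (by positivity) (by linarith)
  · refine (hintprod x).norm.congr (.of_forall fun w => ?_)
    simp only [norm_smul, norm_mul, norm_eq_abs, abs_exp]
    ring
  · have hg : IntegrableOn (fun t => c * Hb * K * (exp (-(lam * t)) * t ^ (β - 1))) (Set.Ioi 0) :=
      (integrableOn_exp_neg_mul_mul_rpow hlam hβ0).const_mul _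
    refine (norm_integral_le_of_norm_le hg ?_).trans ?_
    · filter_upwards [ae_restrict_mem measurableSet_Ioi] with t ht
      have h := norm_integral_le_of_norm_le_kernel volume ht hβ1 (hbound x t ht)
      rw [hfin, ← hK] at h
      exact h.trans_eq (by ring)
    · rw [integral_const_mul, integral_exp_neg_mul_mul_rpow hlam hβ0]
      calc c * Hb * K * (lam ^ (-β) * Gamma β) = C₁ * lam ^ (-β) * Hb := by rw [hC₁]; ring
        _ ≤ (1 + C₁ + C₂) * lam ^ (-β) * (Mb + Hb) := by gcongr <;> linarith
  · have hg : IntegrableOn (fun t => c * K * (2 + 2 ^ (d + 1 : ℝ)) * Hb * ‖x - x'‖ ^ θ *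
        (exp (-(lam * t)) * t ^ (β - θ - 1))) (Set.Ioi 0) :=
      (integrableOn_exp_neg_mul_mul_rpow hlam hβθ).const_mul _
    rw [← integral_sub (hintprod x).integral_prod_left (hintprod x').integral_prod_left]
    refine (norm_integral_le_of_norm_le hg ?_).trans ?_
    · filter_upwards [ae_restrict_mem measurableSet_Ioi] with t ht
      rw [hscale, hscale, ← smul_sub, norm_smul, norm_of_nonneg (exp_pos _).le, mul_left_comm]
      gcongr
      have h := norm_integral_smul_sub_integral_smul_le volume (x := x) (x' := x')
        hβ0 hβ1 hθ0.le hc.le ht hbm hbM hHb hbH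
        (measurable_gradient_snd hpm (hpd t ht) x).aestronglyMeasurable
        (measurable_gradient_snd hpm (hpd t ht) x').aestronglyMeasurable
        (by simpa only [hfin] using hpg t ht x) (by simpa only [hfin] using hpg t ht x')
        (hpg0 t ht x') (by simpa only [hfin] using hpgg t ht x x')
      simpa only [hfin] using h
    · rw [integral_const_mul, integral_exp_neg_mul_mul_rpow hlam hβθ, neg_sub]
      calc c * K * (2 + 2 ^ (d + 1 : ℝ)) * Hb * ‖x - x'‖ ^ θ * (lam ^ (θ - β) * Gamma (β - θ))
          = C₂ * lam ^ (θ - β) * ‖x - x'‖ ^ θ * Hb := by rw [hC₂]; ring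
        _ ≤ (1 + C₁ + C₂) * lam ^ (θ - β) * ‖x - x'‖ ^ θ * (Mb + Hb) := by gcongr <;> linarith
end

section
/- (Solution of the parametrix integral equation) Fix d ≥ 1, β ∈ (0,1) and K > 0. Let q₀: (0,1] × ℝ^d × ℝ^d → ℝ be measurable such that |q₀(t,x,y)| ≤ K ϱ_0^β(t, x−y) for all t ∈ (0,1], x, y, and such that for every γ ∈ (0,β) there is K_γ > 0 with |q₀(t,x,y) − q₀(t,x′,y)| ≤ K_γ (|x−x′|^{β−γ} ∧ 1) [ (ϱ_γ^0 + ϱ_{γ−β}^β)(t, x−y) + (ϱ_γ^0 + ϱ_{γ−β}^β)(t, x′−y) ] for all t ∈ (0,1], x, x′, y. Define q_n recursively by q_n(t,x,y) := ∫_0^t ∫_{ℝ^d} q₀(t−s, x, z) q_{n−1}(s, z, y) dz ds. Then the series q(t,x,y) := Σ_{n≥0} q_n(t,x,y) converges absolutely for every t ∈ (0,1] and x, y ∈ ℝ^d, the function q satisfies the integral equation q(t,x,y) = q₀(t,x,y) + ∫_0^t ∫_{ℝ^d} q₀(t−s, x, z) q(s, z, y) dz ds, and there are constants C > 0 (depending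 on d, K) and, for each γ ∈ (0,β), C_γ > 0 such that |q(t,x,y)| ≤ C ( ϱ_0^β(t,x−y) + ϱ_β^0(t,x−y) ) and |q(t,x,y) − q(t,x′,y)| ≤ C_γ (|x−x′|^{β−γ} ∧ 1) [ (ϱ_γ^0 + ϱ_{γ−β}^β)(t, x−y) + (ϱ_γ^0 + ϱ_{γ−β}^β)(t, x′−y) ]. -/
open MeasureTheory Real

/-- `vr d γ β t x = t^γ (‖x‖^β ∧ 1) (‖x‖+t)^{-d-1}`, the kernel-type function ϱ_γ^β. -/
noncomputable def vr (d : ℕ) (γ β : ℝ) (t : ℝ) (x : EuclideanSpace ℝ (Fin d)) : ℝ :=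
  t ^ γ * min (‖x‖ ^ β) 1 * (‖x‖ + t) ^ (-(d : ℝ) - 1)

/-- The radially decreasing profile `min (r^β) 1 * r^(-d-1)`, written as a minimum of powers. -/
noncomputable def profile (d : ℕ) (β r : ℝ) : ℝ :=
  min (r ^ (β - d - 1)) (r ^ (-(d : ℝ) - 1))

lemma profile_nonneg (d : ℕ) (β : ℝ) {r : ℝ} (hr : 0 ≤ r) : 0 ≤ profile d β r :=
  le_min (rpow_nonneg hr _) (rpow_nonneg hr _)

@[fun_prop]
lemma measurable_profile (d : ℕ) (β : ℝ) : Measurable (profile d β) := by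
  unfold profile; fun_prop

lemma profile_antitone {d : ℕ} {β r R : ℝ} (hβ : β < 1) (hr : 0 < r) (h : r ≤ R) :
    profile d β R ≤ profile d β r := by
  have hd : (0 : ℝ) ≤ d := Nat.cast_nonneg d
  exact min_le_min (rpow_le_rpow_of_nonpos hr h (by linarith))
    (rpow_le_rpow_of_nonpos hr h (by linarith))

lemma profile_half_le {d : ℕ} {β R : ℝ} (hβ : 0 < β) (hR : 0 < R) :
    profile d β (R / 2) ≤ 2 ^ (d + 1) * profile d β R := by
  have key : ∀ a : ℝ, -(d : ℝ) - 1 ≤ a → (R / 2) ^ a ≤ 2 ^ (d + 1) * R ^ a := by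
    intro a ha
    have h2 : ((2 : ℝ) ^ a)⁻¹ ≤ 2 ^ (d + 1) := by
      rw [← rpow_neg (by norm_num), ← rpow_natCast]
      exact rpow_le_rpow_of_exponent_le (by norm_num) (by push_cast; linarith)
    rw [div_rpow hR.le (by norm_num), div_eq_mul_inv, mul_comm]
    exact mul_le_mul_of_nonneg_right h2 (rpow_nonneg hR.le _)
  unfold profile
  rw [mul_min_of_nonneg _ _ (by positivity)]
  exact min_le_min (key _ (by linarith)) (key _ le_rfl)

lemma profile_mul_le {d : ℕ} {β r r' R : ℝ} (hβ : β ∈ Set.Ioo (0 : ℝ) 1) (hr : 0 < r)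
    (hr' : 0 < r') (hR : 0 < R) (h : R ≤ r + r') :
    profile d β r * profile d β r' ≤
      2 ^ (d + 1) * profile d β R * (profile d β r + profile d β r') := by
  have h1 := profile_nonneg d β hr.le
  have h2 := profile_nonneg d β hr'.le
  have h3 := profile_half_le (d := d) hβ.1 hR
  have h4 : 0 ≤ 2 ^ (d + 1) * profile d β R := mul_nonneg (by positivity) (profile_nonneg d β hR.le)
  rcases le_total r r' with hle | hle
  · have h5 := (profile_antitone (d := d) (r := R / 2) (R := r') hβ.2 (by linarith)
      (by linarith)).trans h3
    nlinarith [mul_le_mul_of_nonneg_left h5 h1, mul_nonneg h4 h2]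
  · have h5 := (profile_antitone (d := d) (r := R / 2) (R := r) hβ.2 (by linarith)
      (by linarith)).trans h3
    nlinarith [mul_le_mul_of_nonneg_right h5 h2, mul_nonneg h4 h1]

lemma profile_eq {d : ℕ} {β r : ℝ} (hr : 0 < r) :
    profile d β r = min (r ^ β) 1 * r ^ (-(d : ℝ) - 1) := by
  rw [min_mul_of_nonneg _ _ (rpow_nonneg hr.le _), ← rpow_add hr, one_mul, profile]
  congr 2; ring

section Comparison

variable {d : ℕ} {β t : ℝ} (x : EuclideanSpace ℝ (Fin d))

lemma vr_nonneg (γ : ℝ) (ht : 0 ≤ t) : 0 ≤ vr d γ β t x := by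
  unfold vr; positivity

lemma vr_zero_le_profile (hβ : β ∈ Set.Ioo (0 : ℝ) 1) (ht : t ∈ Set.Ioc (0 : ℝ) 1) :
    vr d 0 β t x ≤ profile d β (‖x‖ + t) := by
  have h0 := norm_nonneg x
  have ht0 := ht.1
  rw [profile_eq (by linarith), vr, rpow_zero, one_mul]
  gcongr
  · exact hβ.1.le
  · linarith

lemma vr_beta_le_profile (hβ : β ∈ Set.Ioo (0 : ℝ) 1) (ht : t ∈ Set.Ioc (0 : ℝ) 1) :
    vr d β 0 t x ≤ profile d β (‖x‖ + t) := by
  have h0 := norm_nonneg x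
  have ht0 := ht.1
  rw [profile_eq (by linarith), vr, rpow_zero, min_self, mul_one]
  gcongr
  exact le_min (rpow_le_rpow ht0.le (by linarith) hβ.1.le) (rpow_le_one ht0.le ht.2 hβ.1.le)

lemma profile_le_vr (hβ : β ∈ Set.Ioo (0 : ℝ) 1) (ht : t ∈ Set.Ioc (0 : ℝ) 1) :
    profile d β (‖x‖ + t) ≤ vr d 0 β t x + vr d β 0 t x := by
  have h0 := norm_nonneg x
  have ht0 := ht.1
  rw [profile_eq (by linarith), vr, vr, rpow_zero, rpow_zero, min_self, mul_one, one_mul,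
    ← add_mul]
  gcongr
  have h1 := rpow_add_le_add_rpow h0 ht0.le hβ.1.le hβ.2.le
  have h2 := rpow_nonneg ht0.le β
  rcases le_total (‖x‖ ^ β) 1 with h | h
  · rw [min_eq_left h]; exact (min_le_left _ _).trans h1
  · rw [min_eq_right h]; exact (min_le_right _ _).trans (by linarith)

lemma vr_add_vr_eq (γ : ℝ) (ht : 0 < t) :
    vr d γ 0 t x + vr d (γ - β) β t x = t ^ (γ - β) * (vr d 0 β t x + vr d β 0 t x) := by
  have : t ^ γ = t ^ (γ - β) * t ^ β := by rw [← rpow_add ht]; congr 1; ring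
  simp only [vr, this, rpow_zero, min_self]
  ring

end Comparison

section Space

variable {d : ℕ} {β : ℝ}

lemma integrable_one_add_norm_rpow (hβ : β < 1) :
    Integrable fun z : EuclideanSpace ℝ (Fin d) => (1 + ‖z‖) ^ (β - d - 1) := by
  have := integrable_one_add_norm (E := EuclideanSpace ℝ (Fin d)) (μ := volume)
    (r := d + 1 - β) (by rw [finrank_euclideanSpace_fin]; linarith)
  convert this using 3
  ring

lemma integrable_integral_profile_le (hβ : β < 1) {s : ℝ} (hs : 0 < s) :
    (Integrable fun z : EuclideanSpace ℝ (Fin d) => profile d β (‖z‖ + s)) ∧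
    ∫ z : EuclideanSpace ℝ (Fin d), profile d β (‖z‖ + s) ≤
      (∫ z : EuclideanSpace ℝ (Fin d), (1 + ‖z‖) ^ (β - d - 1)) * s ^ (β - 1) := by
  have hint := (integrable_one_add_norm_rpow (d := d) hβ)
  have hint' := ((integrable_comp_smul_iff volume _ (inv_ne_zero hs.ne')).2 hint).const_mul
    (s ^ (β - d - 1))
  have hle : ∀ z : EuclideanSpace ℝ (Fin d), profile d β (‖z‖ + s) ≤
      s ^ (β - d - 1) * (1 + ‖s⁻¹ • z‖) ^ (β - d - 1) := by
    intro z
    rw [← mul_rpow hs.le (by positivity), norm_smul, norm_inv, norm_of_nonneg hs.le]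
    refine (min_le_left _ _).trans_eq ?_
    congr 1
    field_simp
    ring
  have hprof : Integrable fun z : EuclideanSpace ℝ (Fin d) => profile d β (‖z‖ + s) := by
    refine hint'.mono' (by fun_prop : Measurable _).aestronglyMeasurable (ae_of_all _ fun z => ?_)
    rw [norm_of_nonneg (profile_nonneg d β (by positivity))]
    exact hle z
  refine ⟨hprof, (integral_mono hprof hint' hle).trans_eq ?_⟩
  rw [integral_const_mul,
    Measure.integral_comp_smul volume
      (fun z : EuclideanSpace ℝ (Fin d) => (1 + ‖z‖) ^ (β - d - 1)) s⁻¹,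
    finrank_euclideanSpace_fin, inv_pow, inv_inv, abs_of_pos (by positivity), smul_eq_mul,
    ← mul_assoc, ← rpow_natCast, ← rpow_add hs, mul_comm]
  congr 2
  ring

end Space

lemma integrableOn_integral_reflect {t : ℝ} (ht : 0 < t) {g : ℝ → ℝ}
    (hg : IntegrableOn g (Set.Ioo 0 t)) :
    IntegrableOn (fun s => g (t - s)) (Set.Ioo 0 t) ∧
      ∫ s in Set.Ioo 0 t, g (t - s) = ∫ s in Set.Ioo 0 t, g s := by
  have h1 : IntervalIntegrable g volume 0 t :=
    (intervalIntegrable_iff_integrableOn_Ioo_of_le ht.le).2 hg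
  have h2 := (h1.comp_sub_left t).symm
  simp only [sub_zero, sub_self] at h2
  refine ⟨(intervalIntegrable_iff_integrableOn_Ioo_of_le ht.le).1 h2, ?_⟩
  rw [← integral_Ioc_eq_integral_Ioo, ← integral_Ioc_eq_integral_Ioo,
    ← intervalIntegral.integral_of_le ht.le, ← intervalIntegral.integral_of_le ht.le,
    intervalIntegral.integral_comp_sub_left]
  simp

lemma integrableOn_integral_rpow_mul_exp_le {β l : ℝ} (hβ : 0 < β) (hl : 0 < l) (t : ℝ) :
    IntegrableOn (fun s => s ^ (β - 1) * exp (-(l * s))) (Set.Ioo 0 t) ∧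
      ∫ s in Set.Ioo 0 t, s ^ (β - 1) * exp (-(l * s)) ≤ (1 / l) ^ β * Gamma β := by
  have h : IntegrableOn (fun s : ℝ => s ^ (β - 1) * exp (-(l * s))) (Set.Ioi 0) := by
    have := integrableOn_rpow_mul_exp_neg_mul_rpow (p := 1) (s := β - 1) (b := l) (by linarith)
      zero_lt_one hl
    simpa [neg_mul] using this
  refine ⟨h.mono_set Set.Ioo_subset_Ioi_self, ?_⟩
  rw [← Real.integral_rpow_mul_exp_neg_mul_Ioi hβ hl]
  refine setIntegral_mono_set h ?_ (ae_of_all _ Set.Ioo_subset_Ioi_self)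
  filter_upwards [ae_restrict_mem measurableSet_Ioi] with s hs
  exact mul_nonneg (rpow_nonneg (le_of_lt hs) _) (exp_pos _).le

lemma integrableOn_integral_rpow_le {γ t : ℝ} (hγ : 0 < γ) (ht : t ∈ Set.Ioc (0 : ℝ) 1) :
    IntegrableOn (fun s => s ^ (γ - 1)) (Set.Ioo 0 t) ∧
      ∫ s in Set.Ioo 0 t, s ^ (γ - 1) ≤ 1 / γ := by
  refine ⟨(intervalIntegrable_iff_integrableOn_Ioo_of_le ht.1.le).1
    (intervalIntegral.intervalIntegrable_rpow' (by linarith)), ?_⟩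
  rw [← integral_Ioc_eq_integral_Ioo, ← intervalIntegral.integral_of_le ht.1.le,
    integral_rpow (Or.inl (by linarith)), sub_add_cancel, zero_rpow hγ.ne', sub_zero]
  gcongr
  exact rpow_le_one ht.1.le ht.2 hγ.le

/-- Measure over which the space-time convolutions up to time `t` are taken. -/
noncomputable abbrev slab (d : ℕ) (t : ℝ) : Measure (ℝ × EuclideanSpace ℝ (Fin d)) :=
  (volume.restrict (Set.Ioo 0 t)).prod volume

lemma ae_slab_mem (d : ℕ) (t : ℝ) : ∀ᵐ p ∂slab d t, p.1 ∈ Set.Ioo 0 t :=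
  Measure.quasiMeasurePreserving_fst.ae (ae_restrict_mem measurableSet_Ioo)

/-- Constant in the space-time convolution estimate. -/
noncomputable def convConst (d : ℕ) (β : ℝ) : ℝ :=
  2 ^ (d + 1) * ∫ z : EuclideanSpace ℝ (Fin d), (1 + ‖z‖) ^ (β - d - 1)

lemma convConst_nonneg (d : ℕ) (β : ℝ) : 0 ≤ convConst d β :=
  mul_nonneg (by positivity) (integral_nonneg fun z => by positivity)

lemma integrable_integral_conv_profile_le {d : ℕ} {β t : ℝ} (hβ : β ∈ Set.Ioo (0 : ℝ) 1)
    (ht : 0 < t) (x y : EuclideanSpace ℝ (Fin d)) {w g : ℝ → ℝ} (hw : Measurable w)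
    (hw0 : ∀ s ∈ Set.Ioo 0 t, 0 ≤ w s) (hg : IntegrableOn g (Set.Ioo 0 t))
    (hwg : ∀ s ∈ Set.Ioo 0 t, w s * ((t - s) ^ (β - 1) + s ^ (β - 1)) ≤ g s + g (t - s)) :
    Integrable (fun p => w p.1 *
        (profile d β (‖x - p.2‖ + (t - p.1)) * profile d β (‖p.2 - y‖ + p.1))) (slab d t) ∧
    ∫ p, w p.1 * (profile d β (‖x - p.2‖ + (t - p.1)) * profile d β (‖p.2 - y‖ + p.1)) ∂slab d t
      ≤ convConst d β * profile d β (‖x - y‖ + t) * (2 * ∫ s in Set.Ioo 0 t, g s) := by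
  set c := ∫ z : EuclideanSpace ℝ (Fin d), (1 + ‖z‖) ^ (β - d - 1) with hc
  set P := profile d β (‖x - y‖ + t) with hP
  have hP0 : 0 ≤ P := profile_nonneg d β (by positivity)
  have hc0 : 0 ≤ c := integral_nonneg fun z => by positivity
  have hS : ∀ s ∈ Set.Ioo 0 t,
      (Integrable fun z => profile d β (‖x - z‖ + (t - s)) + profile d β (‖z - y‖ + s)) ∧
      ∫ z, (profile d β (‖x - z‖ + (t - s)) + profile d β (‖z - y‖ + s)) ≤
        c * ((t - s) ^ (β - 1) + s ^ (β - 1)) := by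
    intro s hs
    obtain ⟨i1, b1⟩ := integrable_integral_profile_le (d := d) hβ.2 (sub_pos.2 hs.2)
    obtain ⟨i2, b2⟩ := integrable_integral_profile_le (d := d) hβ.2 hs.1
    have j1 := i1.comp_sub_left x
    have j2 := i2.comp_sub_right y
    refine ⟨j1.add j2, ?_⟩
    rw [integral_add j1 j2,
      integral_sub_left_eq_self (fun z => profile d β (‖z‖ + (t - s))) volume x,
      integral_sub_right_eq_self (fun z => profile d β (‖z‖ + s)) y, mul_add]
    exact add_le_add b1 b2
  set G : ℝ × EuclideanSpace ℝ (Fin d) → ℝ := fun p => w p.1 * (2 ^ (d + 1) * P *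
    (profile d β (‖x - p.2‖ + (t - p.1)) + profile d β (‖p.2 - y‖ + p.1))) with hG
  have hGm : Measurable G := by fun_prop
  have hGn : ∀ s ∈ Set.Ioo 0 t, ∀ z, 0 ≤ G (s, z) := by
    intro s hs z
    have := hs.1
    have := sub_pos.2 hs.2
    exact mul_nonneg (hw0 s hs) (mul_nonneg (by positivity)
      (add_nonneg (profile_nonneg d β (by positivity)) (profile_nonneg d β (by positivity))))
  have hGs : ∀ s ∈ Set.Ioo 0 t, ∫ z, G (s, z) ≤ convConst d β * P * (g s + g (t - s)) := by
    intro s hs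
    simp only [hG]
    rw [integral_const_mul, integral_const_mul]
    calc _ ≤ w s * (2 ^ (d + 1) * P * (c * ((t - s) ^ (β - 1) + s ^ (β - 1)))) := by
          refine mul_le_mul_of_nonneg_left (mul_le_mul_of_nonneg_left (hS s hs).2 ?_) (hw0 s hs)
          positivity
      _ = convConst d β * P * (w s * ((t - s) ^ (β - 1) + s ^ (β - 1))) := by
          rw [convConst]; ring
      _ ≤ _ := mul_le_mul_of_nonneg_left (hwg s hs) (mul_nonneg (convConst_nonneg d β) hP0)
  obtain ⟨hgr, hgr'⟩ := integrableOn_integral_reflect ht hg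
  have hbd : IntegrableOn (fun s => convConst d β * P * (g s + g (t - s))) (Set.Ioo 0 t) :=
    (hg.add hgr).const_mul _
  have hGint : Integrable G (slab d t) := by
    rw [integrable_prod_iff hGm.aestronglyMeasurable]
    constructor
    · filter_upwards [ae_restrict_mem measurableSet_Ioo] with s hs
      exact ((hS s hs).1.const_mul (2 ^ (d + 1) * P)).const_mul (w s)
    · refine hbd.mono' hGm.norm.stronglyMeasurable.integral_prod_right'.aestronglyMeasurable ?_
      filter_upwards [ae_restrict_mem measurableSet_Ioo] with s hs
      rw [norm_of_nonneg (integral_nonneg fun z => norm_nonneg _)]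
      simpa only [norm_of_nonneg (hGn s hs _)] using hGs s hs
  have hle : ∀ᵐ p ∂slab d t,
      ‖w p.1 * (profile d β (‖x - p.2‖ + (t - p.1)) * profile d β (‖p.2 - y‖ + p.1))‖ ≤ G p := by
    filter_upwards [ae_slab_mem d t] with p hp
    have h1 := hp.1
    have h2 := sub_pos.2 hp.2
    have h3 : 0 < ‖x - p.2‖ + (t - p.1) := by positivity
    have h4 : 0 < ‖p.2 - y‖ + p.1 := by positivity
    rw [norm_of_nonneg (mul_nonneg (hw0 _ hp)
      (mul_nonneg (profile_nonneg d β h3.le) (profile_nonneg d β h4.le)))]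
    refine mul_le_mul_of_nonneg_left (profile_mul_le hβ h3 h4 (by positivity) ?_) (hw0 _ hp)
    linarith [norm_sub_le_norm_sub_add_norm_sub x p.2 y]
  have hint := hGint.mono' (by fun_prop : Measurable _).aestronglyMeasurable hle
  refine ⟨hint, (integral_mono_ae hint hGint
    (hle.mono fun p hp => (le_abs_self _).trans hp)).trans ?_⟩
  rw [integral_prod _ hGint]
  calc _ ≤ ∫ s in Set.Ioo 0 t, convConst d β * P * (g s + g (t - s)) :=
        setIntegral_mono_on hGint.integral_prod_left hbd measurableSet_Ioo hGs
    _ = _ := by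
        rw [integral_const_mul, integral_add hg hgr, hgr']; ring

lemma exp_weight_conv_le {d : ℕ} {β l t : ℝ} (hβ : β ∈ Set.Ioo (0 : ℝ) 1) (hl : 0 < l)
    (ht : 0 < t) (x y : EuclideanSpace ℝ (Fin d)) :
    Integrable (fun p => exp (l * p.1) *
        (profile d β (‖x - p.2‖ + (t - p.1)) * profile d β (‖p.2 - y‖ + p.1))) (slab d t) ∧
    ∫ p, exp (l * p.1) *
        (profile d β (‖x - p.2‖ + (t - p.1)) * profile d β (‖p.2 - y‖ + p.1)) ∂slab d t
      ≤ convConst d β * (4 * ((1 / l) ^ β * Gamma β)) *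
        (exp (l * t) * profile d β (‖x - y‖ + t)) := by
  obtain ⟨hi, hle⟩ := integrableOn_integral_rpow_mul_exp_le hβ.1 hl t
  have hwg : ∀ s ∈ Set.Ioo 0 t, exp (l * s) * ((t - s) ^ (β - 1) + s ^ (β - 1)) ≤
      2 * exp (l * t) * (s ^ (β - 1) * exp (-(l * s))) +
      2 * exp (l * t) * ((t - s) ^ (β - 1) * exp (-(l * (t - s)))) := by
    intro s hs
    have h1 : exp (l * s) = exp (l * t) * exp (-(l * (t - s))) := by rw [← exp_add]; congr 1; ring
    have h2 : 0 ≤ s ^ (β - 1) := rpow_nonneg hs.1.le _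
    have h3 : 0 ≤ (t - s) ^ (β - 1) := rpow_nonneg (sub_pos.2 hs.2).le _
    have h4 : s ^ (β - 1) * exp (-(l * (t - s))) ≤
        s ^ (β - 1) * exp (-(l * s)) + (t - s) ^ (β - 1) * exp (-(l * (t - s))) := by
      rcases le_total s (t - s) with h | h
      · have : s ^ (β - 1) * exp (-(l * (t - s))) ≤ s ^ (β - 1) * exp (-(l * s)) := by gcongr
        linarith [mul_nonneg h3 (exp_pos (-(l * (t - s)))).le]
      · have : s ^ (β - 1) ≤ (t - s) ^ (β - 1) :=
          rpow_le_rpow_of_nonpos (sub_pos.2 hs.2) h (by linarith [hβ.2])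
        linarith [mul_le_mul_of_nonneg_right this (exp_pos (-(l * (t - s)))).le,
          mul_nonneg h2 (exp_pos (-(l * s))).le]
    have h5 := mul_le_mul_of_nonneg_left h4 (exp_pos (l * t)).le
    have h6 := mul_nonneg (exp_pos (l * t)).le (mul_nonneg h2 (exp_pos (-(l * s))).le)
    rw [h1]
    linarith
  obtain ⟨h1, h2⟩ := integrable_integral_conv_profile_le hβ ht x y (w := fun s => exp (l * s))
    (by fun_prop) (fun s _ => (exp_pos _).le) (hi.const_mul (2 * exp (l * t))) hwg
  refine ⟨h1, h2.trans ?_⟩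
  rw [integral_const_mul]
  have h3 : 0 ≤ convConst d β * profile d β (‖x - y‖ + t) :=
    mul_nonneg (convConst_nonneg d β) (profile_nonneg d β (by positivity))
  calc _ ≤ convConst d β * profile d β (‖x - y‖ + t) *
        (2 * (2 * exp (l * t) * ((1 / l) ^ β * Gamma β))) := by gcongr
    _ = _ := by ring

lemma rpow_weight_conv_le {d : ℕ} {β γ t : ℝ} (hβ : β ∈ Set.Ioo (0 : ℝ) 1)
    (hγ : γ ∈ Set.Ioo 0 β) (ht : t ∈ Set.Ioc (0 : ℝ) 1) (x y : EuclideanSpace ℝ (Fin d)) :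
    Integrable (fun p => (t - p.1) ^ (γ - β) *
        (profile d β (‖x - p.2‖ + (t - p.1)) * profile d β (‖p.2 - y‖ + p.1))) (slab d t) ∧
    ∫ p, (t - p.1) ^ (γ - β) *
        (profile d β (‖x - p.2‖ + (t - p.1)) * profile d β (‖p.2 - y‖ + p.1)) ∂slab d t
      ≤ convConst d β * (4 / γ) * profile d β (‖x - y‖ + t) := by
  obtain ⟨hi, hle⟩ := integrableOn_integral_rpow_le hγ.1 ht
  have hwg : ∀ s ∈ Set.Ioo 0 t, (t - s) ^ (γ - β) * ((t - s) ^ (β - 1) + s ^ (β - 1)) ≤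
      2 * s ^ (γ - 1) + 2 * (t - s) ^ (γ - 1) := by
    intro s hs
    have hts := sub_pos.2 hs.2
    have h1 : ∀ u : ℝ, 0 < u → u ^ (γ - β) * u ^ (β - 1) = u ^ (γ - 1) := by
      intro u hu; rw [← rpow_add hu]; congr 1; ring
    have h2 : 0 ≤ s ^ (γ - 1) := rpow_nonneg hs.1.le _
    have h3 : 0 ≤ (t - s) ^ (γ - 1) := rpow_nonneg hts.le _
    rw [mul_add, h1 _ hts]
    rcases le_total s (t - s) with h | h
    · have := mul_le_mul_of_nonneg_right
        (rpow_le_rpow_of_nonpos hs.1 h (by linarith [hγ.2] : γ - β ≤ 0))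
        (rpow_nonneg hs.1.le (β - 1))
      rw [h1 _ hs.1] at this
      linarith
    · have := mul_le_mul_of_nonneg_left
        (rpow_le_rpow_of_nonpos hts h (by linarith [hβ.2] : β - 1 ≤ 0))
        (rpow_nonneg hts.le (γ - β))
      rw [h1 _ hts] at this
      linarith
  obtain ⟨h1, h2⟩ := integrable_integral_conv_profile_le hβ ht.1 x y
    (w := fun s => (t - s) ^ (γ - β)) (by fun_prop)
    (fun s hs => rpow_nonneg (sub_pos.2 hs.2).le _) (hi.const_mul 2) hwg
  refine ⟨h1, h2.trans ?_⟩
  rw [integral_const_mul]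
  have h3 : 0 ≤ convConst d β * profile d β (‖x - y‖ + t) :=
    mul_nonneg (convConst_nonneg d β) (profile_nonneg d β (by have := ht.1; positivity))
  calc _ ≤ convConst d β * profile d β (‖x - y‖ + t) * (2 * (2 * (1 / γ))) := by gcongr
    _ = _ := by ring

lemma integrable_tsum_hasSum_integral {α : Type*} {m : MeasurableSpace α} {μ : Measure α}
    {F : ℕ → α → ℝ} {H : α → ℝ} (hF : ∀ n, AEStronglyMeasurable (F n) μ) (hH : Integrable H μ)
    (hb : ∀ᵐ p ∂μ, ∀ n, |F n p| ≤ (1 / 2) ^ n * H p) :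
    Integrable (fun p => ∑' n, F n p) μ ∧
      HasSum (fun n => ∫ p, F n p ∂μ) (∫ p, ∑' n, F n p ∂μ) := by
  have hs : ∀ a : ℝ, HasSum (fun n : ℕ => (1 / 2 : ℝ) ^ n * a) (2 * a) := fun a =>
    hasSum_geometric_two.mul_right a
  have hsum : ∀ᵐ p ∂μ, Summable fun n => F n p := hb.mono fun p hp =>
    Summable.of_norm_bounded (hs (H p)).summable hp
  refine ⟨(hH.const_mul 2).mono' ?_ ?_, ?_⟩
  · refine aestronglyMeasurable_of_tendsto_ae Filter.atTop
      (f := fun n p => ∑ i ∈ Finset.range n, F i p)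
      (fun n => Finset.aestronglyMeasurable_fun_sum _ fun i _ => hF i) ?_
    exact hsum.mono fun p hp => hp.hasSum.tendsto_sum_nat
  · exact hb.mono fun p hp => tsum_of_norm_bounded (hs (H p)) hp
  · refine hasSum_integral_of_dominated_convergence (fun n p => (1 / 2) ^ n * H p) hF
      (fun n => hb.mono fun p hp => hp n) (ae_of_all _ fun p => (hs (H p)).summable) ?_
      (hsum.mono fun p hp => hp.hasSum)
    simp only [(hs _).tsum_eq]
    exact hH.const_mul 2

lemma intervalIntegral_integral_eq_slab {d : ℕ} {t : ℝ} (ht : 0 < t)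
    {F : ℝ × EuclideanSpace ℝ (Fin d) → ℝ} (hF : Integrable F (slab d t)) :
    ∫ s in (0 : ℝ)..t, ∫ z, F (s, z) = ∫ p, F p ∂slab d t := by
  rw [integral_prod _ hF, intervalIntegral.integral_of_le ht.le, integral_Ioc_eq_integral_Ioo]

section Iterates

variable {d : ℕ} {β K : ℝ}
  {q : ℕ → ℝ → EuclideanSpace ℝ (Fin d) → EuclideanSpace ℝ (Fin d) → ℝ}

lemma exists_measurable_iterate
    (hmeas : Measurable
      (fun w : ℝ × EuclideanSpace ℝ (Fin d) × EuclideanSpace ℝ (Fin d) => q 0 w.1 w.2.1 w.2.2))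
    (hrec : ∀ n : ℕ, ∀ t ∈ Set.Ioc (0:ℝ) 1, ∀ x y,
      q (n + 1) t x y = ∫ s in (0:ℝ)..t, ∫ z, q 0 (t - s) x z * q n s z y) (n : ℕ) :
    ∃ Q : ℝ × EuclideanSpace ℝ (Fin d) × EuclideanSpace ℝ (Fin d) → ℝ, Measurable Q ∧
      ∀ t ∈ Set.Ioc (0 : ℝ) 1, ∀ x y, Q (t, x, y) = q n t x y := by
  induction n with
  | zero => exact ⟨_, hmeas, fun _ _ _ _ => rfl⟩
  | succ n ih =>
    obtain ⟨Q, hQ, hQq⟩ := ih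
    refine ⟨fun w => ∫ s, ∫ z, if 0 < s ∧ s < w.1 then
      q 0 (w.1 - s) w.2.1 z * Q (s, z, w.2.2) else 0, ?_, ?_⟩
    · have h : Measurable fun v :
          ((ℝ × EuclideanSpace ℝ (Fin d) × EuclideanSpace ℝ (Fin d)) × ℝ) ×
            EuclideanSpace ℝ (Fin d) =>
          if 0 < v.1.2 ∧ v.1.2 < v.1.1.1 then
            q 0 (v.1.1.1 - v.1.2) v.1.1.2.1 v.2 * Q (v.1.2, v.2, v.1.1.2.2) else 0 := by
        refine Measurable.ite ?_ (Measurable.mul ?_ (by fun_prop)) measurable_const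
        · exact (measurableSet_lt measurable_const measurable_fst.snd).inter
            (measurableSet_lt measurable_fst.snd measurable_fst.fst.fst)
        · exact hmeas.comp (g := fun w :
            ℝ × EuclideanSpace ℝ (Fin d) × EuclideanSpace ℝ (Fin d) => q 0 w.1 w.2.1 w.2.2)
            (f := fun v : ((ℝ × EuclideanSpace ℝ (Fin d) × EuclideanSpace ℝ (Fin d)) × ℝ) ×
              EuclideanSpace ℝ (Fin d) => (v.1.1.1 - v.1.2, v.1.1.2.1, v.2)) (by fun_prop)
      exact h.stronglyMeasurable.integral_prod_right'.integral_prod_right'.measurable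
    · intro t ht x y
      rw [hrec n t ht x y, intervalIntegral.integral_of_le ht.1.le, integral_Ioc_eq_integral_Ioo,
        ← integral_indicator measurableSet_Ioo]
      refine integral_congr_ae (ae_of_all _ fun s => ?_)
      dsimp only
      by_cases hs : s ∈ Set.Ioo 0 t
      · rw [Set.indicator_of_mem hs]
        refine integral_congr_ae (ae_of_all _ fun z => ?_)
        dsimp only
        rw [if_pos (show 0 < s ∧ s < t from hs), hQq s ⟨hs.1, hs.2.le.trans ht.2⟩]
      · rw [Set.indicator_of_notMem hs]
        simp only [if_neg (show ¬(0 < s ∧ s < t) from hs), integral_zero]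

lemma aestronglyMeasurable_kernel_mul_iterate
    (hmeas : Measurable
      (fun w : ℝ × EuclideanSpace ℝ (Fin d) × EuclideanSpace ℝ (Fin d) => q 0 w.1 w.2.1 w.2.2))
    (hrec : ∀ n : ℕ, ∀ t ∈ Set.Ioc (0:ℝ) 1, ∀ x y,
      q (n + 1) t x y = ∫ s in (0:ℝ)..t, ∫ z, q 0 (t - s) x z * q n s z y) (n : ℕ)
    {t : ℝ} (ht : t ∈ Set.Ioc (0 : ℝ) 1) (x y : EuclideanSpace ℝ (Fin d)) :
    AEStronglyMeasurable (fun p => q 0 (t - p.1) x p.2 * q n p.1 p.2 y) (slab d t) := by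
  obtain ⟨Q, hQ, hQq⟩ := exists_measurable_iterate hmeas hrec n
  have h1 : Measurable fun p : ℝ × EuclideanSpace ℝ (Fin d) => q 0 (t - p.1) x p.2 :=
    hmeas.comp (g := fun w :
      ℝ × EuclideanSpace ℝ (Fin d) × EuclideanSpace ℝ (Fin d) => q 0 w.1 w.2.1 w.2.2)
      (f := fun p : ℝ × EuclideanSpace ℝ (Fin d) => (t - p.1, x, p.2)) (by fun_prop)
  have h2 : Measurable fun p : ℝ × EuclideanSpace ℝ (Fin d) => Q (p.1, p.2, y) := by fun_prop
  refine (h1.mul h2).aestronglyMeasurable.congr ?_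
  filter_upwards [ae_slab_mem d t] with p hp
  rw [Pi.mul_apply, hQq p.1 ⟨hp.1, hp.2.le.trans ht.2⟩]

lemma abs_kernel_mul_le (hβ : β ∈ Set.Ioo (0 : ℝ) 1) (hK : 0 < K)
    (h0 : ∀ t ∈ Set.Ioc (0:ℝ) 1, ∀ x y, |q 0 t x y| ≤ K * vr d 0 β t (x - y))
    {n : ℕ} {l : ℝ} (hn : ∀ t ∈ Set.Ioc (0 : ℝ) 1, ∀ x y,
      |q n t x y| ≤ K * (1 / 2) ^ n * (exp (l * t) * profile d β (‖x - y‖ + t)))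
    {t : ℝ} (ht : t ∈ Set.Ioc (0 : ℝ) 1) (x y : EuclideanSpace ℝ (Fin d))
    {p : ℝ × EuclideanSpace ℝ (Fin d)} (hp : p.1 ∈ Set.Ioo 0 t) :
    |q 0 (t - p.1) x p.2 * q n p.1 p.2 y| ≤ (1 / 2) ^ n * (K ^ 2 * (exp (l * p.1) *
        (profile d β (‖x - p.2‖ + (t - p.1)) * profile d β (‖p.2 - y‖ + p.1)))) := by
  have hts : t - p.1 ∈ Set.Ioc (0 : ℝ) 1 := ⟨sub_pos.2 hp.2, by linarith [hp.1, ht.2]⟩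
  have h1 : |q 0 (t - p.1) x p.2| ≤ K * profile d β (‖x - p.2‖ + (t - p.1)) :=
    (h0 _ hts x p.2).trans (mul_le_mul_of_nonneg_left (vr_zero_le_profile _ hβ hts) hK.le)
  have h2 := hn p.1 ⟨hp.1, hp.2.le.trans ht.2⟩ p.2 y
  rw [abs_mul]
  refine (mul_le_mul h1 h2 (abs_nonneg _) ((abs_nonneg _).trans h1)).trans_eq ?_
  ring

lemma exists_iterate_bound (hβ : β ∈ Set.Ioo (0 : ℝ) 1) (hK : 0 < K)
    (hmeas : Measurable
      (fun w : ℝ × EuclideanSpace ℝ (Fin d) × EuclideanSpace ℝ (Fin d) => q 0 w.1 w.2.1 w.2.2))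
    (h0 : ∀ t ∈ Set.Ioc (0:ℝ) 1, ∀ x y, |q 0 t x y| ≤ K * vr d 0 β t (x - y))
    (hrec : ∀ n : ℕ, ∀ t ∈ Set.Ioc (0:ℝ) 1, ∀ x y,
      q (n + 1) t x y = ∫ s in (0:ℝ)..t, ∫ z, q 0 (t - s) x z * q n s z y) :
    ∃ l > (0 : ℝ), ∀ n : ℕ, ∀ t ∈ Set.Ioc (0 : ℝ) 1, ∀ x y,
      |q n t x y| ≤ K * (1 / 2) ^ n * (exp (l * t) * profile d β (‖x - y‖ + t)) := by
  obtain ⟨l, hl, hlK⟩ : ∃ l > (0 : ℝ),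
      K * (convConst d β * (4 * ((1 / l) ^ β * Gamma β))) ≤ 1 / 2 := by
    have h : Filter.Tendsto
        (fun l : ℝ => K * (convConst d β * (4 * ((1 / l) ^ β * Gamma β)))) Filter.atTop
        (nhds (K * (convConst d β * (4 * (0 * Gamma β))))) := by
      refine (((Filter.Tendsto.mul_const _ ?_).const_mul _).const_mul _).const_mul _
      have := (tendsto_rpow_neg_atTop hβ.1)
      refine this.congr' ?_
      filter_upwards [Filter.eventually_gt_atTop 0] with l hl
      rw [one_div, inv_rpow hl.le, rpow_neg hl.le]
    have h' := (h.eventually (ge_mem_nhds (by norm_num : _ < (1 / 2 : ℝ)))).and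
      (Filter.eventually_gt_atTop (0 : ℝ))
    obtain ⟨l, h1, h2⟩ := h'.exists
    exact ⟨l, h2, h1⟩
  refine ⟨l, hl, fun n => ?_⟩
  induction n with
  | zero =>
    intro t ht x y
    have h1 : 0 ≤ profile d β (‖x - y‖ + t) := profile_nonneg d β (by have := ht.1; positivity)
    have h2 : 1 ≤ exp (l * t) := one_le_exp (mul_nonneg hl.le ht.1.le)
    rw [pow_zero, mul_one]
    exact (h0 t ht x y).trans (mul_le_mul_of_nonneg_left
      ((vr_zero_le_profile _ hβ ht).trans (le_mul_of_one_le_left h1 h2)) hK.le)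
  | succ n ih =>
    intro t ht x y
    obtain ⟨hi, hle⟩ := exp_weight_conv_le hβ hl ht.1 x y
    have hb : ∀ᵐ p ∂slab d t, ‖q 0 (t - p.1) x p.2 * q n p.1 p.2 y‖ ≤
        (1 / 2) ^ n * (K ^ 2 * (exp (l * p.1) *
          (profile d β (‖x - p.2‖ + (t - p.1)) * profile d β (‖p.2 - y‖ + p.1)))) :=
      (ae_slab_mem d t).mono fun p hp => abs_kernel_mul_le hβ hK h0 ih ht x y hp
    have hi' := (hi.const_mul (K ^ 2)).const_mul ((1 / 2) ^ n)
    have hF := hi'.mono' (aestronglyMeasurable_kernel_mul_iterate hmeas hrec n ht x y) hb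
    rw [hrec n t ht x y, intervalIntegral_integral_eq_slab ht.1 hF]
    refine (norm_integral_le_of_norm_le hi' hb).trans ?_
    rw [integral_const_mul, integral_const_mul]
    have h1 : 0 ≤ exp (l * t) * profile d β (‖x - y‖ + t) :=
      mul_nonneg (exp_pos _).le (profile_nonneg d β (by have := ht.1; positivity))
    calc _ ≤ (1 / 2) ^ n * (K ^ 2 * (convConst d β * (4 * ((1 / l) ^ β * Gamma β)) *
          (exp (l * t) * profile d β (‖x - y‖ + t)))) := by gcongr
      _ = K * (1 / 2) ^ n * (K * (convConst d β * (4 * ((1 / l) ^ β * Gamma β)))) *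
          (exp (l * t) * profile d β (‖x - y‖ + t)) := by ring
      _ ≤ K * (1 / 2) ^ n * (1 / 2) * (exp (l * t) * profile d β (‖x - y‖ + t)) := by gcongr
      _ = _ := by ring

lemma abs_iterate_succ_sub_le (hβ : β ∈ Set.Ioo (0 : ℝ) 1) (hK : 0 < K)
    (hmeas : Measurable
      (fun w : ℝ × EuclideanSpace ℝ (Fin d) × EuclideanSpace ℝ (Fin d) => q 0 w.1 w.2.1 w.2.2))
    (h0 : ∀ t ∈ Set.Ioc (0:ℝ) 1, ∀ x y, |q 0 t x y| ≤ K * vr d 0 β t (x - y))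
    (hrec : ∀ n : ℕ, ∀ t ∈ Set.Ioc (0:ℝ) 1, ∀ x y,
      q (n + 1) t x y = ∫ s in (0:ℝ)..t, ∫ z, q 0 (t - s) x z * q n s z y)
    {n : ℕ} {l : ℝ} (hl : 0 < l) (hn : ∀ t ∈ Set.Ioc (0 : ℝ) 1, ∀ x y,
      |q n t x y| ≤ K * (1 / 2) ^ n * (exp (l * t) * profile d β (‖x - y‖ + t)))
    {γ Kγ : ℝ} (hγ : γ ∈ Set.Ioo 0 β) (hKγ : 0 < Kγ)
    (hHol : ∀ t ∈ Set.Ioc (0:ℝ) 1, ∀ x x' y,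
      |q 0 t x y - q 0 t x' y| ≤ Kγ * min (‖x - x'‖ ^ (β - γ)) 1 *
        ((vr d γ 0 t (x - y) + vr d (γ - β) β t (x - y)) +
         (vr d γ 0 t (x' - y) + vr d (γ - β) β t (x' - y))))
    {t : ℝ} (ht : t ∈ Set.Ioc (0 : ℝ) 1) (x x' y : EuclideanSpace ℝ (Fin d)) :
    |q (n + 1) t x y - q (n + 1) t x' y| ≤
      (1 / 2) ^ n * (2 * Kγ * K * exp l * (convConst d β * (4 / γ)) *
        min (‖x - x'‖ ^ (β - γ)) 1 *
        ((vr d γ 0 t (x - y) + vr d (γ - β) β t (x - y)) +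
         (vr d γ 0 t (x' - y) + vr d (γ - β) β t (x' - y)))) := by
  have hF : ∀ x, Integrable (fun p => q 0 (t - p.1) x p.2 * q n p.1 p.2 y) (slab d t) := fun x =>
    (((exp_weight_conv_le hβ hl ht.1 x y).1.const_mul (K ^ 2)).const_mul ((1 / 2) ^ n)).mono'
      (aestronglyMeasurable_kernel_mul_iterate hmeas hrec n ht x y)
      ((ae_slab_mem d t).mono fun p hp => abs_kernel_mul_le hβ hK h0 hn ht x y hp)
  set M := min (‖x - x'‖ ^ (β - γ)) 1 with hM
  have hM0 : 0 ≤ M := le_min (by positivity) zero_le_one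
  set W : EuclideanSpace ℝ (Fin d) → ℝ × EuclideanSpace ℝ (Fin d) → ℝ := fun x p =>
    (t - p.1) ^ (γ - β) *
      (profile d β (‖x - p.2‖ + (t - p.1)) * profile d β (‖p.2 - y‖ + p.1)) with hW
  have hWi : ∀ x, Integrable (W x) (slab d t) := fun x => (rpow_weight_conv_le hβ hγ ht x y).1
  have hWle : ∀ x, ∫ p, W x p ∂slab d t ≤ convConst d β * (4 / γ) *
      (vr d γ 0 t (x - y) + vr d (γ - β) β t (x - y)) := by
    intro x
    refine (rpow_weight_conv_le hβ hγ ht x y).2.trans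
      (mul_le_mul_of_nonneg_left ?_
      (mul_nonneg (convConst_nonneg d β) (by have := hγ.1; positivity)))
    rw [vr_add_vr_eq _ _ ht.1]
    have h1 := profile_le_vr (x - y) hβ ht
    have h2 : 1 ≤ t ^ (γ - β) :=
      one_le_rpow_of_pos_of_le_one_of_nonpos ht.1 ht.2 (by linarith [hγ.2])
    exact h1.trans (le_mul_of_one_le_left (add_nonneg (vr_nonneg _ _ ht.1.le)
      (vr_nonneg _ _ ht.1.le)) h2)
  set A := 2 * Kγ * K * exp l * M with hA
  have hA0 : 0 ≤ A := by positivity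
  have hb : ∀ᵐ p ∂slab d t,
      ‖q 0 (t - p.1) x p.2 * q n p.1 p.2 y - q 0 (t - p.1) x' p.2 * q n p.1 p.2 y‖ ≤
        (1 / 2) ^ n * (A * (W x p + W x' p)) := by
    filter_upwards [ae_slab_mem d t] with p hp
    have hts : t - p.1 ∈ Set.Ioc (0 : ℝ) 1 := ⟨sub_pos.2 hp.2, by linarith [hp.1, ht.2]⟩
    have hp1 : p.1 ∈ Set.Ioc (0 : ℝ) 1 := ⟨hp.1, hp.2.le.trans ht.2⟩
    have hvr : ∀ x, vr d γ 0 (t - p.1) (x - p.2) + vr d (γ - β) β (t - p.1) (x - p.2) ≤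
        (t - p.1) ^ (γ - β) * (2 * profile d β (‖x - p.2‖ + (t - p.1))) := by
      intro x
      rw [vr_add_vr_eq _ _ hts.1]
      refine mul_le_mul_of_nonneg_left ?_ (rpow_nonneg hts.1.le _)
      linarith [vr_zero_le_profile (x - p.2) hβ hts, vr_beta_le_profile (x - p.2) hβ hts]
    have h1 := (hHol _ hts x x' p.2).trans
      (mul_le_mul_of_nonneg_left (add_le_add (hvr x) (hvr x')) (by positivity))
    have hP : 0 ≤ profile d β (‖p.2 - y‖ + p.1) :=
      profile_nonneg d β (by have := hp.1; positivity)
    have h2 : |q n p.1 p.2 y| ≤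
        K * (1 / 2) ^ n * (exp l * profile d β (‖p.2 - y‖ + p.1)) := by
      refine (hn p.1 hp1 p.2 y).trans ?_
      have : l * p.1 ≤ l := mul_le_of_le_one_right hl.le hp1.2
      gcongr
    rw [← sub_mul, norm_mul]
    refine (mul_le_mul h1 h2 (abs_nonneg _) ((abs_nonneg _).trans h1)).trans_eq ?_
    rw [hA, hW]
    ring
  have hbi := (((hWi x).add (hWi x')).const_mul A).const_mul ((1 / 2) ^ n)
  rw [hrec n t ht x y, hrec n t ht x' y, intervalIntegral_integral_eq_slab ht.1 (hF x),
    intervalIntegral_integral_eq_slab ht.1 (hF x'), ← integral_sub (hF x) (hF x')]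
  refine (norm_integral_le_of_norm_le hbi hb).trans ?_
  simp only [Pi.add_apply]
  rw [integral_const_mul, integral_const_mul, integral_add (hWi x) (hWi x')]
  calc _ ≤ (1 / 2) ^ n * (A * (_ + _)) := by
        refine mul_le_mul_of_nonneg_left (mul_le_mul_of_nonneg_left
          (add_le_add (hWle x) (hWle x')) hA0) (by positivity)
    _ = _ := by rw [hA]; ring

end Iterates

/-- Solution of the parametrix integral equation (Lemma 2.7): the series
`q = Σ qₙ` converges absolutely, solves `q = q₀ + q₀ ⊛ q`, and satisfies the
stated pointwise and Hölder bounds. -/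
theorem stmt_17 (d : ℕ) (hd : 1 ≤ d) (β : ℝ) (hβ : β ∈ Set.Ioo (0:ℝ) 1)
    (K : ℝ) (hK : 0 < K)
    (q : ℕ → ℝ → EuclideanSpace ℝ (Fin d) → EuclideanSpace ℝ (Fin d) → ℝ)
    (hmeas : Measurable
      (fun w : ℝ × EuclideanSpace ℝ (Fin d) × EuclideanSpace ℝ (Fin d) =>
        q 0 w.1 w.2.1 w.2.2))
    (h0 : ∀ t ∈ Set.Ioc (0:ℝ) 1, ∀ x y, |q 0 t x y| ≤ K * vr d 0 β t (x - y))
    (hHol : ∀ γ ∈ Set.Ioo (0:ℝ) β, ∃ Kγ > (0:ℝ), ∀ t ∈ Set.Ioc (0:ℝ) 1, ∀ x x' y,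
      |q 0 t x y - q 0 t x' y| ≤ Kγ * min (‖x - x'‖ ^ (β - γ)) 1 *
        ((vr d γ 0 t (x - y) + vr d (γ - β) β t (x - y)) +
         (vr d γ 0 t (x' - y) + vr d (γ - β) β t (x' - y))))
    (hrec : ∀ n : ℕ, ∀ t ∈ Set.Ioc (0:ℝ) 1, ∀ x y,
      q (n + 1) t x y = ∫ s in (0:ℝ)..t, ∫ z, q 0 (t - s) x z * q n s z y) :
    (∀ t ∈ Set.Ioc (0:ℝ) 1, ∀ x y, Summable fun n : ℕ => |q n t x y|) ∧
    (∀ t ∈ Set.Ioc (0:ℝ) 1, ∀ x y,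
      (∑' n : ℕ, q n t x y) =
        q 0 t x y + ∫ s in (0:ℝ)..t, ∫ z, q 0 (t - s) x z * (∑' n : ℕ, q n s z y)) ∧
    (∃ C > (0:ℝ), ∀ t ∈ Set.Ioc (0:ℝ) 1, ∀ x y,
      |∑' n : ℕ, q n t x y| ≤ C * (vr d 0 β t (x - y) + vr d β 0 t (x - y))) ∧
    (∀ γ ∈ Set.Ioo (0:ℝ) β, ∃ Cγ > (0:ℝ), ∀ t ∈ Set.Ioc (0:ℝ) 1, ∀ x x' y,
      |(∑' n : ℕ, q n t x y) - ∑' n : ℕ, q n t x' y| ≤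
        Cγ * min (‖x - x'‖ ^ (β - γ)) 1 *
          ((vr d γ 0 t (x - y) + vr d (γ - β) β t (x - y)) +
           (vr d γ 0 t (x' - y) + vr d (γ - β) β t (x' - y)))) := by
  obtain ⟨l, hl, hq⟩ := exists_iterate_bound hβ hK hmeas h0 hrec
  have hgeom : ∀ a : ℝ, HasSum (fun n : ℕ => (1 / 2 : ℝ) ^ n * a) (2 * a) := fun a =>
    hasSum_geometric_two.mul_right a
  have hq' : ∀ t ∈ Set.Ioc (0 : ℝ) 1, ∀ x y n, ‖q n t x y‖ ≤
      (1 / 2) ^ n * (K * (exp (l * t) * profile d β (‖x - y‖ + t))) := fun t ht x y n =>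
    (hq n t ht x y).trans_eq (by ring)
  have hsum : ∀ t ∈ Set.Ioc (0 : ℝ) 1, ∀ x y, Summable fun n : ℕ => q n t x y :=
    fun t ht x y => Summable.of_norm_bounded (hgeom _).summable (hq' t ht x y)
  refine ⟨fun t ht x y => Summable.of_nonneg_of_le (fun n => abs_nonneg _) (hq' t ht x y)
    (hgeom _).summable, fun t ht x y => ?_, ⟨2 * K * exp l, by positivity, fun t ht x y => ?_⟩,
    fun γ hγ => ?_⟩
  · obtain ⟨hi, hs⟩ := integrable_tsum_hasSum_integral
      (fun n => aestronglyMeasurable_kernel_mul_iterate hmeas hrec n ht x y)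
      ((exp_weight_conv_le hβ hl ht.1 x y).1.const_mul (K ^ 2))
      ((ae_slab_mem d t).mono fun p hp n => abs_kernel_mul_le hβ hK h0 (hq n) ht x y hp)
    have hF : ∀ n, Integrable (fun p => q 0 (t - p.1) x p.2 * q n p.1 p.2 y) (slab d t) :=
      fun n => (((exp_weight_conv_le hβ hl ht.1 x y).1.const_mul (K ^ 2)).const_mul
        ((1 / 2) ^ n)).mono' (aestronglyMeasurable_kernel_mul_iterate hmeas hrec n ht x y)
        ((ae_slab_mem d t).mono fun p hp => abs_kernel_mul_le hβ hK h0 (hq n) ht x y hp)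
    rw [(hsum t ht x y).tsum_eq_zero_add]
    simp only [hrec _ t ht x y, intervalIntegral_integral_eq_slab ht.1 (hF _), hs.tsum_eq]
    rw [← intervalIntegral_integral_eq_slab ht.1 hi]
    simp only [tsum_mul_left]
  · have h1 : l * t ≤ l := mul_le_of_le_one_right hl.le ht.2
    have h2 : 0 ≤ profile d β (‖x - y‖ + t) := profile_nonneg d β (by have := ht.1; positivity)
    refine (tsum_of_norm_bounded (hgeom _) (hq' t ht x y)).trans ?_
    calc _ ≤ 2 * (K * (exp l * profile d β (‖x - y‖ + t))) := by gcongr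
      _ = 2 * K * exp l * profile d β (‖x - y‖ + t) := by ring
      _ ≤ _ := mul_le_mul_of_nonneg_left (profile_le_vr _ hβ ht) (by positivity)
  · obtain ⟨Kγ, hKγ, hHolγ⟩ := hHol γ hγ
    have hc : 0 ≤ convConst d β * (4 / γ) :=
      mul_nonneg (convConst_nonneg d β) (by have := hγ.1; positivity)
    refine ⟨Kγ + 2 * (2 * Kγ * K * exp l * (convConst d β * (4 / γ))), by positivity,
      fun t ht x x' y => ?_⟩
    have hs := hsum t ht x y
    have hs' := hsum t ht x' y
    rw [← hs.tsum_sub hs', (hs.sub hs').tsum_eq_zero_add]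
    have h := tsum_of_norm_bounded (f := fun n => q (n + 1) t x y - q (n + 1) t x' y)
      (hgeom _) fun n => abs_iterate_succ_sub_le hβ hK hmeas h0 hrec
      hl (hq n) hγ hKγ hHolγ ht x x' y
    refine (abs_add_le _ _).trans ((add_le_add (hHolγ t ht x x' y) h).trans_eq ?_)
    ring
end
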